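/- arXiv:2006.07047 — 3 statements merged into one kernel-verified Lean document; each statement's English description precedes it below -/
import Mathlib

section
/- Wigner–Araki–Yanase theorem (Yanase-condition version): Suppose the tuple ⟨U, φ, (Q_i)⟩ is a discrete measurement scheme for the self-adjoint operator A = Σ_{i∈I} a_i P_i on H_S satisfying the probability reproducibility condition. Let L_S and L_A be self-adjoint operators on H_S and H_A respectively such that U commutes with L_S⊗1 + 1⊗L_A (conservation law). If moreover Q_i commutes with L_A for every i ∈ I (the Yanase condition), then A commutes with L_S, i.e. A∘L_S = L_S∘A. -/
open scoped InnerProductSpace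
open ContinuousLinearMap

noncomputable section

/-- An abstract tensor product structure realising the Hilbert space `H` as the tensor
product of the Hilbert spaces `E` and `F`, with the induced inner product
`⟪x⊗y, x'⊗y'⟫ = ⟪x,x'⟫⟪y,y'⟫`, and with the induced action `tmap B C = B ⊗ C` of pairs
of operators. -/
structure TensorStruct (E F H : Type*)
    [NormedAddCommGroup E] [InnerProductSpace ℂ E]
    [NormedAddCommGroup F] [InnerProductSpace ℂ F]
    [NormedAddCommGroup H] [InnerProductSpace ℂ H] where
  tmul : E →ₗ[ℂ] F →ₗ[ℂ] H
  inner_tmul : ∀ (x x' : E) (y y' : F),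
    ⟪tmul x y, tmul x' y'⟫_ℂ = ⟪x, x'⟫_ℂ * ⟪y, y'⟫_ℂ
  span_tmul : Submodule.span ℂ {z : H | ∃ x y, z = tmul x y} = ⊤
  tmap : (E →L[ℂ] E) → (F →L[ℂ] F) → (H →L[ℂ] H)
  tmap_tmul : ∀ (B : E →L[ℂ] E) (C : F →L[ℂ] F) (x : E) (y : F),
    tmap B C (tmul x y) = tmul (B x) (C y)

namespace TensorStruct

variable {E F H : Type*}
  [NormedAddCommGroup E] [InnerProductSpace ℂ E]
  [NormedAddCommGroup F] [InnerProductSpace ℂ F]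
  [NormedAddCommGroup H] [InnerProductSpace ℂ H]

/-- Two operators agreeing on elementary tensors are equal. -/
theorem clm_ext (T : TensorStruct E F H) {X Y : H →L[ℂ] H}
    (h : ∀ x y, X (T.tmul x y) = Y (T.tmul x y)) : X = Y := by
  apply ContinuousLinearMap.coe_injective
  apply LinearMap.ext_on T.span_tmul
  rintro _ ⟨x, y, rfl⟩
  exact h x y

theorem tmap_mul (T : TensorStruct E F H) (B B' : E →L[ℂ] E) (C C' : F →L[ℂ] F) :
    T.tmap B C * T.tmap B' C' = T.tmap (B * B') (C * C') :=
  T.clm_ext fun x y => by simp [tmap_tmul]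

theorem sum_tmap_one_right (T : TensorStruct E F H) {ι : Type*} [Fintype ι]
    (Q : ι → (F →L[ℂ] F)) (hQ : ∑ i, Q i = 1) : ∑ i, T.tmap 1 (Q i) = 1 := by
  refine T.clm_ext fun x y => ?_
  have h := congrArg (fun R : F →L[ℂ] F => T.tmul x (R y)) hQ
  simpa [sum_apply, tmap_tmul] using h

/-- If `B` and `C` are symmetric, then so is `B ⊗ C`. -/
theorem inner_tmap_comm (T : TensorStruct E F H) {B : E →L[ℂ] E} {C : F →L[ℂ] F}
    (hB : ∀ x x', ⟪B x, x'⟫_ℂ = ⟪x, B x'⟫_ℂ) (hC : ∀ y y', ⟪C y, y'⟫_ℂ = ⟪y, C y'⟫_ℂ)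
    (u v : H) : ⟪T.tmap B C u, v⟫_ℂ = ⟪u, T.tmap B C v⟫_ℂ := by
  have hu : u ∈ Submodule.span ℂ {z : H | ∃ x y, z = T.tmul x y} := by simp [T.span_tmul]
  have hv : v ∈ Submodule.span ℂ {z : H | ∃ x y, z = T.tmul x y} := by simp [T.span_tmul]
  induction hu using Submodule.span_induction with
  | zero => simp
  | add _ _ _ _ h₁ h₂ => simp [h₁, h₂]
  | smul c _ _ h => simp [h]
  | mem _ h =>
    obtain ⟨x, y, rfl⟩ := h
    induction hv using Submodule.span_induction with
    | zero => simp
    | add _ _ _ _ h₁ h₂ => simp [h₁, h₂]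
    | smul c _ _ h => simp [h]
    | mem _ h =>
      obtain ⟨x', y', rfl⟩ := h
      simp only [tmap_tmul, inner_tmul, hB, hC]

end TensorStruct

theorem inner_apply_comm_of_adjoint_eq {E : Type*} [NormedAddCommGroup E] [InnerProductSpace ℂ E]
    [FiniteDimensional ℂ E] {R : E →L[ℂ] E} (hR : adjoint R = R) (x y : E) :
    ⟪R x, y⟫_ℂ = ⟪x, R y⟫_ℂ := by
  rw [← adjoint_inner_right, hR]

/-- **Wigner–Araki–Yanase theorem (Yanase-condition version).**
If `⟨U, φ, (Q i)⟩` is a discrete measurement scheme for the self-adjoint operator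
`A = ∑ i, a i • P i` on `H_S` satisfying the probability reproducibility condition,
`U` commutes with the additive conserved quantity `L_S⊗1 + 1⊗L_A`, and each pointer
projection `Q i` commutes with `L_A` (the Yanase condition), then `A` commutes with `L_S`. -/
theorem WAY_yanase_condition
    {HS HA H : Type*}
    [NormedAddCommGroup HS] [InnerProductSpace ℂ HS] [FiniteDimensional ℂ HS]
    [NormedAddCommGroup HA] [InnerProductSpace ℂ HA] [FiniteDimensional ℂ HA]
    [NormedAddCommGroup H] [InnerProductSpace ℂ H] [FiniteDimensional ℂ H]
    (T : TensorStruct HS HA H)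
    {ι : Type*} [Fintype ι]
    -- the measured observable `A = ∑ i, a i • P i`, with distinct eigenvalues `a i` and
    -- pairwise orthogonal orthogonal projections `P i` summing to `1`
    (a : ι → ℝ) (ha : Function.Injective a)
    (P : ι → (HS →L[ℂ] HS))
    (hPsa : ∀ i, adjoint (P i) = P i)
    (hPidem : ∀ i, P i * P i = P i)
    (hPorth : ∀ i j, i ≠ j → P i * P j = 0)
    (hPsum : ∑ i, P i = 1)
    -- the pointer: pairwise orthogonal orthogonal projections `Q i` summing to `1`
    (Q : ι → (HA →L[ℂ] HA))
    (hQsa : ∀ i, adjoint (Q i) = Q i)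
    (hQidem : ∀ i, Q i * Q i = Q i)
    (hQorth : ∀ i j, i ≠ j → Q i * Q j = 0)
    (hQsum : ∑ i, Q i = 1)
    -- the unitary measurement coupling `U` and the initial apparatus unit vector `φ`
    (U : H →L[ℂ] H) (hU : adjoint U * U = 1 ∧ U * adjoint U = 1)
    (φ : HA) (hφ : ‖φ‖ = 1)
    -- self-adjoint operators `L_S`, `L_A`
    (LS : HS →L[ℂ] HS) (hLS : adjoint LS = LS)
    (LA : HA →L[ℂ] HA) (hLA : adjoint LA = LA)
    -- the conservation law: `U` commutes with `L_S⊗1 + 1⊗L_A`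
    (hcons : U * (T.tmap LS 1 + T.tmap 1 LA) = (T.tmap LS 1 + T.tmap 1 LA) * U)
    -- the probability reproducibility condition
    (hPRC : ∀ (ψ : HS) (i : ι),
      ⟪ψ, P i ψ⟫_ℂ = ⟪U (T.tmul ψ φ), T.tmap 1 (Q i) (U (T.tmul ψ φ))⟫_ℂ)
    -- the Yanase condition
    (hYanase : ∀ i, Q i * LA = LA * Q i) :
    (∑ i, (a i : ℂ) • P i) * LS = LS * ∑ i, (a i : ℂ) • P i := by
  have hUinner (x y : H) : ⟪U x, U y⟫_ℂ = ⟪x, y⟫_ℂ := by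
    rw [← adjoint_inner_right, ← mul_apply_eq_comp (adjoint U), hU.1, one_apply_eq_self y]
  set V : HS → H := fun ψ => U (T.tmul ψ φ) with hV
  set q : ι → (H →L[ℂ] H) := fun i => T.tmap 1 (Q i) with hq
  set L : H →L[ℂ] H := T.tmap LS 1 + T.tmap 1 LA with hL
  have hqsymm (i : ι) (u v : H) : ⟪q i u, v⟫_ℂ = ⟪u, q i v⟫_ℂ :=
    T.inner_tmap_comm (fun _ _ => rfl) (inner_apply_comm_of_adjoint_eq (hQsa i)) u v
  have hqidem (i : ι) : q i * q i = q i := by simp [hq, T.tmap_mul, hQidem]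
  have hqsum : ∑ i, q i = 1 := T.sum_tmap_one_right Q hQsum
  have hqL (i : ι) : q i * L = L * q i := by
    simp [hq, hL, mul_add, add_mul, T.tmap_mul, hYanase]
  have hVsum (f : ι → HS) : V (∑ j, f j) = ∑ j, V (f j) := by simp [hV]
  have hqV_off (i j : ι) (hij : i ≠ j) (ψ : HS) : q i (V (P j ψ)) = 0 := by
    rw [← inner_self_eq_zero (𝕜 := ℂ), hqsymm, ← mul_apply_eq_comp (q i), hqidem,
      ← hPRC, ← mul_apply_eq_comp (P i), hPorth i j hij]
    simp
  have hqV (i : ι) (ψ : HS) : q i (V ψ) = V (P i ψ) := by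
    have h₁ : q i (V ψ) = q i (V (P i ψ)) := by
      have h : ψ = ∑ j, P j ψ := by rw [← sum_apply, hPsum, one_apply_eq_self ψ]
      conv_lhs => rw [h, hVsum, map_sum]
      exact Finset.sum_eq_single i (fun j _ hj => hqV_off i j hj.symm ψ) (by simp)
    have h₂ : V (P i ψ) = q i (V (P i ψ)) := by
      have h : V (P i ψ) = ∑ j, q j (V (P i ψ)) := by
        rw [← sum_apply, hqsum, one_apply_eq_self (V (P i ψ))]
      conv_lhs => rw [h]
      exact Finset.sum_eq_single i (fun j _ hj => hqV_off j i hj ψ) (by simp)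
    rw [h₁, ← h₂]
  have hVL (ψ ψ' : HS) :
      ⟪V ψ, L (V ψ')⟫_ℂ = ⟪ψ, LS ψ'⟫_ℂ + ⟪ψ, ψ'⟫_ℂ * ⟪φ, LA φ⟫_ℂ := by
    have h : L (V ψ') = U (L (T.tmul ψ' φ)) := by
      rw [hV, ← mul_apply_eq_comp L, ← hcons, mul_apply_eq_comp U]
    rw [h, hUinner]
    simp [hL, T.tmap_tmul, T.inner_tmul, hφ]
  have hPL (i : ι) : P i * LS = LS * P i := by
    ext ψ'
    refine ext_inner_left ℂ fun ψ => ?_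
    have h : ⟪V (P i ψ), L (V ψ')⟫_ℂ = ⟪V ψ, L (V (P i ψ'))⟫_ℂ := by
      rw [← hqV, ← hqV, hqsymm, ← mul_apply_eq_comp (q i), hqL, mul_apply_eq_comp L]
    rw [hVL, hVL, inner_apply_comm_of_adjoint_eq (hPsa i),
      inner_apply_comm_of_adjoint_eq (hPsa i)] at h
    simpa only [mul_apply_eq_comp, add_left_inj] using h
  simp [Finset.sum_mul, Finset.mul_sum, hPL]

end
end

section
/- Wigner–Araki–Yanase theorem (repeatability version): Suppose the tuple ⟨U, φ, (Q_i)⟩ is a discrete measurement scheme for the self-adjoint operator A = Σ_{i∈I} a_i P_i on H_S satisfying the probability reproducibility condition. Let L_S and L_A be self-adjoint operators on H_S and H_A respectively such that U commutes with L_S⊗1 + 1⊗L_A (conservation law). If moreover the measurement is repeatable, i.e. ⟨U(ψ⊗φ), (P_i⊗Q_i) U(ψ⊗φ)⟩ = ⟨ψ, P_i ψ⟩ for all ψ ∈ H_S and all i ∈ I, then A commutes with L_S, i.e. A∘L_S = L_S∘A. -/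
open scoped InnerProductSpace
open ContinuousLinearMap

noncomputable section

namespace TensorStruct

variable {E F H : Type*}
  [NormedAddCommGroup E] [InnerProductSpace ℂ E]
  [NormedAddCommGroup F] [InnerProductSpace ℂ F]
  [NormedAddCommGroup H] [InnerProductSpace ℂ H]

theorem tmap_zero_left (T : TensorStruct E F H) (C : F →L[ℂ] F) : T.tmap 0 C = 0 :=
  T.clm_ext fun x y => by simp [T.tmap_tmul]

theorem tmap_zero_right (T : TensorStruct E F H) (B : E →L[ℂ] E) : T.tmap B 0 = 0 :=
  T.clm_ext fun x y => by simp [T.tmap_tmul]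

theorem adjoint_tmap [CompleteSpace E] [CompleteSpace F] [CompleteSpace H]
    (T : TensorStruct E F H) (B : E →L[ℂ] E) (C : F →L[ℂ] F) :
    adjoint (T.tmap B C) = T.tmap (adjoint B) (adjoint C) := by
  refine T.clm_ext fun x y => ext_inner_left ℂ fun v => ?_
  rw [adjoint_inner_right, T.tmap_tmul]
  have hv : v ∈ Submodule.span ℂ {z : H | ∃ x y, z = T.tmul x y} := by
    rw [T.span_tmul]; trivial
  induction hv using Submodule.span_induction with
  | mem v hv =>
    obtain ⟨x', y', rfl⟩ := hv
    simp [T.tmap_tmul, T.inner_tmul, adjoint_inner_right]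
  | zero => simp
  | add u v _ _ hu hv => simp [inner_add_left, hu, hv]
  | smul c u _ hu => simp [inner_smul_left, hu]

end TensorStruct

/-- A vector whose expectation in an orthogonal projection is its squared norm is fixed by it. -/
theorem apply_eq_self_of_inner_apply_eq {H : Type*} [NormedAddCommGroup H]
    [InnerProductSpace ℂ H] [CompleteSpace H] {R : H →L[ℂ] H} (hsa : adjoint R = R)
    (hidem : R * R = R) {v : H} (h : ⟪v, R v⟫_ℂ = ⟪v, v⟫_ℂ) : R v = v := by
  have h1 : ⟪R v, v⟫_ℂ = ⟪v, R v⟫_ℂ := by rw [← adjoint_inner_right, hsa]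
  have h2 : ⟪R v, R v⟫_ℂ = ⟪v, R v⟫_ℂ := by
    rw [← adjoint_inner_right, hsa, ← mul_apply_eq_comp, hidem]
  rw [← sub_eq_zero, ← inner_self_eq_zero (𝕜 := ℂ), inner_sub_sub_self, h1, h2, h]
  ring

/-- If all off-diagonal blocks of `L` with respect to a resolution of the identity vanish, then
`L` commutes with every linear combination of the projections. -/
theorem sum_smul_mul_eq_mul_sum_smul {R A ι : Type*} [CommSemiring R] [Semiring A] [Algebra R A]
    [Fintype ι] (c : ι → R) {P : ι → A} (hsum : ∑ i, P i = 1) {L : A}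
    (hL : ∀ i j, i ≠ j → P i * L * P j = 0) :
    (∑ i, c i • P i) * L = L * ∑ i, c i • P i := by
  have hl : ∀ i, P i * L = P i * L * P i := fun i => by
    conv_lhs => rw [← mul_one (P i * L), ← hsum, Finset.mul_sum]
    exact Finset.sum_eq_single i (fun j _ hj => hL i j hj.symm) (by simp)
  have hr : ∀ i, L * P i = P i * L * P i := fun i => by
    conv_lhs => rw [← one_mul (L * P i), ← hsum, Finset.sum_mul]
    simp only [← mul_assoc]
    exact Finset.sum_eq_single i (fun j _ hj => hL j i hj) (by simp)
  simp only [Finset.sum_mul, Finset.mul_sum, smul_mul_assoc, mul_smul_comm]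
  exact Finset.sum_congr rfl fun i _ => by rw [hl, hr]

/-- **Wigner–Araki–Yanase theorem (repeatability version).**
If `⟨U, φ, (Q i)⟩` is a discrete measurement scheme for the self-adjoint operator
`A = ∑ i, a i • P i` on `H_S` satisfying the probability reproducibility condition,
`U` commutes with the additive conserved quantity `L_S⊗1 + 1⊗L_A`, and the measurement
is repeatable, then `A` commutes with `L_S`. -/
theorem WAY_repeatability
    {HS HA H : Type*}
    [NormedAddCommGroup HS] [InnerProductSpace ℂ HS] [FiniteDimensional ℂ HS]
    [NormedAddCommGroup HA] [InnerProductSpace ℂ HA] [FiniteDimensional ℂ HA]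
    [NormedAddCommGroup H] [InnerProductSpace ℂ H] [FiniteDimensional ℂ H]
    (T : TensorStruct HS HA H)
    {ι : Type*} [Fintype ι]
    -- the measured observable `A = ∑ i, a i • P i`, with distinct eigenvalues `a i` and
    -- pairwise orthogonal orthogonal projections `P i` summing to `1`
    (a : ι → ℝ) (ha : Function.Injective a)
    (P : ι → (HS →L[ℂ] HS))
    (hPsa : ∀ i, adjoint (P i) = P i)
    (hPidem : ∀ i, P i * P i = P i)
    (hPorth : ∀ i j, i ≠ j → P i * P j = 0)
    (hPsum : ∑ i, P i = 1)
    -- the pointer: pairwise orthogonal orthogonal projections `Q i` summing to `1`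
    (Q : ι → (HA →L[ℂ] HA))
    (hQsa : ∀ i, adjoint (Q i) = Q i)
    (hQidem : ∀ i, Q i * Q i = Q i)
    (hQorth : ∀ i j, i ≠ j → Q i * Q j = 0)
    (hQsum : ∑ i, Q i = 1)
    -- the unitary measurement coupling `U` and the initial apparatus unit vector `φ`
    (U : H →L[ℂ] H) (hU : adjoint U * U = 1 ∧ U * adjoint U = 1)
    (φ : HA) (hφ : ‖φ‖ = 1)
    -- self-adjoint operators `L_S`, `L_A`
    (LS : HS →L[ℂ] HS) (hLS : adjoint LS = LS)
    (LA : HA →L[ℂ] HA) (hLA : adjoint LA = LA)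
    -- the conservation law: `U` commutes with `L_S⊗1 + 1⊗L_A`
    (hcons : U * (T.tmap LS 1 + T.tmap 1 LA) = (T.tmap LS 1 + T.tmap 1 LA) * U)
    -- the probability reproducibility condition
    (hPRC : ∀ (ψ : HS) (i : ι),
      ⟪ψ, P i ψ⟫_ℂ = ⟪U (T.tmul ψ φ), T.tmap 1 (Q i) (U (T.tmul ψ φ))⟫_ℂ)
    -- repeatability
    (hRep : ∀ (ψ : HS) (i : ι),
      ⟪U (T.tmul ψ φ), T.tmap (P i) (Q i) (U (T.tmul ψ φ))⟫_ℂ = ⟪ψ, P i ψ⟫_ℂ) :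
    (∑ i, (a i : ℂ) • P i) * LS = LS * ∑ i, (a i : ℂ) • P i := by
  have hUinner : ∀ x y, ⟪U x, U y⟫_ℂ = ⟪x, y⟫_ℂ := fun x y => by
    rw [← adjoint_inner_right, ← mul_apply_eq_comp, hU.1, one_apply_eq_self]
  have hφφ : ⟪φ, φ⟫_ℂ = 1 := by simp [inner_self_eq_norm_sq_to_K, hφ]
  have hfix : ∀ i ψ, T.tmap (P i) (Q i) (U (T.tmul (P i ψ) φ)) = U (T.tmul (P i ψ) φ) := by
    intro i ψ
    apply apply_eq_self_of_inner_apply_eq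
    · rw [T.adjoint_tmap, hPsa, hQsa]
    · rw [T.tmap_mul, hPidem, hQidem]
    · rw [hRep, hUinner, T.inner_tmul, hφφ, mul_one, ← mul_apply_eq_comp, hPidem]
  refine sum_smul_mul_eq_mul_sum_smul _ hPsum fun i j hij => ?_
  have hblock : ∀ (B : HS →L[ℂ] HS) (C : HA →L[ℂ] HA) (x y : HS),
      P i * B * P j = 0 ∨ Q i * C * Q j = 0 →
      ⟪U (T.tmul (P i x) φ), T.tmap B C (U (T.tmul (P j y) φ))⟫_ℂ = 0 := by
    intro B C x y h
    rw [← hfix i x, ← hfix j y, ← adjoint_inner_right, T.adjoint_tmap, hPsa, hQsa,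
      ← mul_apply_eq_comp, ← mul_apply_eq_comp, T.tmap_mul, T.tmap_mul]
    rcases h with h | h
    · rw [h, T.tmap_zero_left]; simp
    · rw [h, T.tmap_zero_right]; simp
  ext y
  refine ext_inner_left ℂ fun x => ?_
  have hPP : ⟪P i x, P j y⟫_ℂ = 0 := by
    rw [← adjoint_inner_right, hPsa, ← mul_apply_eq_comp, hPorth i j hij]; simp
  have key : ⟪U (T.tmul (P i x) φ), (U * (T.tmap LS 1 + T.tmap 1 LA)) (T.tmul (P j y) φ)⟫_ℂ
      = 0 := by
    rw [hcons, mul_apply_eq_comp, add_apply, inner_add_right,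
      hblock LS 1 x y (Or.inr (by rw [mul_one, hQorth i j hij])),
      hblock 1 LA x y (Or.inl (by rw [mul_one, hPorth i j hij])), add_zero]
  rw [mul_apply_eq_comp, hUinner, add_apply, inner_add_right, T.tmap_tmul, T.tmap_tmul, T.inner_tmul,
    T.inner_tmul, one_apply_eq_self, one_apply_eq_self, hφφ, hPP, zero_mul, add_zero, mul_one,
    ← adjoint_inner_right, hPsa] at key
  simpa using key

end
end

section
/- Localisation limit for relativised observables (finite-group version of the approximation theorem of Section 4.4): Let G be a finite group with identity e, g ↦ U_S(g) a unitary representation of G on H_S, and (Q_g)_{g∈G} a family of positive semidefinite operators on H_R with Σ_{g∈G} Q_g = 1. Then for every operator A on H_S and every unit vector η ∈ H_R, ‖Γ_η(¥(A)) − A‖ ≤ 2(1 − ⟨η, Q_e η⟩)·‖A‖ (in operator norm, the expectation ⟨η, Q_e η⟩ being real). In particular, if (η_n) is a sequence of unit vectors in H_R with ⟨η_n, Q_e η_n⟩ → 1, then Γ_{η_n}(¥(A)) → A in operator norm. -/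
open scoped InnerProductSpace
open ContinuousLinearMap

noncomputable section

/-- The relativisation map `¥`, sending an operator `A` on `H_S` to the operator
`¥(A) = ∑ g, (U_S(g) A U_S(g)^*) ⊗ Q_g` on `H_S⊗H_R`. -/
def yen {HS HR H : Type*}
    [NormedAddCommGroup HS] [InnerProductSpace ℂ HS] [FiniteDimensional ℂ HS]
    [NormedAddCommGroup HR] [InnerProductSpace ℂ HR] [FiniteDimensional ℂ HR]
    [NormedAddCommGroup H] [InnerProductSpace ℂ H] [FiniteDimensional ℂ H]
    (T : TensorStruct HS HR H)
    {G : Type*} [Group G] [Fintype G]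
    (US : G → (HS →L[ℂ] HS)) (Q : G → (HR →L[ℂ] HR))
    (A : HS →L[ℂ] HS) : H →L[ℂ] H :=
  ∑ g : G, T.tmap (US g * A * adjoint (US g)) (Q g)

open scoped ComplexOrder

/-- Conjugation by a unitary operator preserves the operator norm. -/
theorem norm_unitary_conj {E : Type*}
    [NormedAddCommGroup E] [InnerProductSpace ℂ E] [CompleteSpace E]
    {U : E →L[ℂ] E} (hU : adjoint U * U = 1 ∧ U * adjoint U = 1) (A : E →L[ℂ] E) :
    ‖U * A * adjoint U‖ = ‖A‖ := by
  have hmem : U ∈ unitary (E →L[ℂ] E) := Unitary.mem_iff.2 hU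
  rw [← star_eq_adjoint, CStarRing.norm_mul_mem_unitary (U * A) (Unitary.star_mem hmem),
    CStarRing.norm_mem_unitary_mul A hmem]

/-- An operator weakly equal to the restriction of `¥(A)` along `η` is the combination of the
conjugates of `A` weighted by the expectations of the effects `Q g` in `η`. -/
theorem eq_sum_of_restrict_yen {HS HR H : Type*}
    [NormedAddCommGroup HS] [InnerProductSpace ℂ HS] [FiniteDimensional ℂ HS]
    [NormedAddCommGroup HR] [InnerProductSpace ℂ HR] [FiniteDimensional ℂ HR]
    [NormedAddCommGroup H] [InnerProductSpace ℂ H] [FiniteDimensional ℂ H]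
    (T : TensorStruct HS HR H)
    {G : Type*} [Group G] [Fintype G]
    (US : G → (HS →L[ℂ] HS)) (Q : G → (HR →L[ℂ] HR)) (A E : HS →L[ℂ] HS) (η : HR)
    (hE : ∀ ψ ψ' : HS,
      ⟪ψ, E ψ'⟫_ℂ = ⟪T.tmul ψ η, yen T US Q A (T.tmul ψ' η)⟫_ℂ) :
    E = ∑ g : G, ⟪η, Q g η⟫_ℂ • (US g * A * adjoint (US g)) := by
  refine ContinuousLinearMap.ext fun x => ext_inner_left ℂ fun y => ?_
  rw [hE]
  simp only [yen, sum_apply, inner_sum, T.tmap_tmul, T.inner_tmul, smul_apply, inner_smul_right]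
  exact Finset.sum_congr rfl fun g _ => mul_comm _ _

/-- A combination of elements of norm at most that of `B i₀`, with nonnegative real weights
summing to one, is within `2 * (1 - w i₀) * ‖B i₀‖` of `B i₀`. -/
theorem norm_sum_smul_sub_le {ι V : Type*} [Fintype ι] [NormedAddCommGroup V] [NormedSpace ℂ V]
    (w : ι → ℂ) (hw : ∀ i, 0 ≤ w i) (hsum : ∑ i, w i = 1) (B : ι → V) (i₀ : ι)
    (hB : ∀ i, ‖B i‖ ≤ ‖B i₀‖) :
    ‖∑ i, w i • B i - B i₀‖ ≤ 2 * (1 - (w i₀).re) * ‖B i₀‖ := by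
  classical
  have hdiff : ∑ i, w i • B i - B i₀ = ∑ i ∈ Finset.univ.erase i₀, w i • (B i - B i₀) := by
    rw [Finset.sum_erase _ (by simp)]
    simp only [smul_sub, Finset.sum_sub_distrib]
    rw [← Finset.sum_smul, hsum, one_smul]
  have hre : ∑ i ∈ Finset.univ.erase i₀, (w i).re = 1 - (w i₀).re := by
    rw [eq_sub_iff_add_eq, Finset.sum_erase_add _ _ (Finset.mem_univ i₀), ← Complex.re_sum, hsum,
      Complex.one_re]
  calc ‖∑ i, w i • B i - B i₀‖
      ≤ ∑ i ∈ Finset.univ.erase i₀, (w i).re * (2 * ‖B i₀‖) := by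
        rw [hdiff]
        refine norm_sum_le_of_le _ fun i _ => ?_
        rw [norm_smul, ← Complex.re_eq_norm.2 (hw i)]
        refine mul_le_mul_of_nonneg_left ?_ (Complex.nonneg_iff.1 (hw i)).1
        linarith [norm_sub_le (B i) (B i₀), hB i]
    _ = 2 * (1 - (w i₀).re) * ‖B i₀‖ := by
        rw [← Finset.sum_mul, hre]
        ring

/-- **Localisation limit for relativised observables (finite-group version).**
For a unitary representation `U_S` of a finite group `G` and a family `(Q_g)` of positive
semidefinite operators on `H_R` summing to `1`: for every operator `A` on `H_S` and every
unit vector `η ∈ H_R`, `‖Γ_η(¥(A)) − A‖ ≤ 2(1 − ⟨η, Q_e η⟩)‖A‖`; in particular, if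
`(η_n)` is a sequence of unit vectors with `⟨η_n, Q_e η_n⟩ → 1`, then
`Γ_{η_n}(¥(A)) → A` in operator norm. -/
theorem localisation_limit
    {HS HR H : Type*}
    [NormedAddCommGroup HS] [InnerProductSpace ℂ HS] [FiniteDimensional ℂ HS]
    [NormedAddCommGroup HR] [InnerProductSpace ℂ HR] [FiniteDimensional ℂ HR]
    [NormedAddCommGroup H] [InnerProductSpace ℂ H] [FiniteDimensional ℂ H]
    (T : TensorStruct HS HR H)
    {G : Type*} [Group G] [Fintype G]
    -- `U_S` is a unitary representation of `G` on `H_S`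
    (US : G → (HS →L[ℂ] HS))
    (hUS1 : US 1 = 1)
    (hUSmul : ∀ g h : G, US (g * h) = US g * US h)
    (hUSuni : ∀ g : G, adjoint (US g) * US g = 1 ∧ US g * adjoint (US g) = 1)
    -- `(Q_g)` is a family of positive semidefinite operators summing to `1`
    (Q : G → (HR →L[ℂ] HR))
    (hQpos : ∀ (g : G) (x : HR), 0 ≤ ⟪x, Q g x⟫_ℂ)
    (hQsum : ∑ g : G, Q g = 1)
    (A : HS →L[ℂ] HS) :
    -- the norm bound `‖Γ_η(¥(A)) − A‖ ≤ 2(1 − ⟨η, Q_e η⟩)‖A‖`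
    (∀ (η : HR), ‖η‖ = 1 →
      ∀ E : HS →L[ℂ] HS,
        (∀ ψ ψ' : HS, ⟪ψ, E ψ'⟫_ℂ = ⟪T.tmul ψ η, yen T US Q A (T.tmul ψ' η)⟫_ℂ) →
        ‖E - A‖ ≤ 2 * (1 - (⟪η, Q 1 η⟫_ℂ).re) * ‖A‖)
    -- the localisation limit: `Γ_{η_n}(¥(A)) → A` in operator norm
    ∧ (∀ (η : ℕ → HR) (E : ℕ → (HS →L[ℂ] HS)),
        (∀ n, ‖η n‖ = 1) →
        (∀ n, ∀ ψ ψ' : HS,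
          ⟪ψ, E n ψ'⟫_ℂ = ⟪T.tmul ψ (η n), yen T US Q A (T.tmul ψ' (η n))⟫_ℂ) →
        Filter.Tendsto (fun n => ⟪η n, Q 1 (η n)⟫_ℂ) Filter.atTop (nhds 1) →
        Filter.Tendsto (fun n => E n) Filter.atTop (nhds A)) := by
  have bound (η : HR) (hη : ‖η‖ = 1) (E : HS →L[ℂ] HS)
      (hE : ∀ ψ ψ' : HS,
        ⟪ψ, E ψ'⟫_ℂ = ⟪T.tmul ψ η, yen T US Q A (T.tmul ψ' η)⟫_ℂ) :
      ‖E - A‖ ≤ 2 * (1 - (⟪η, Q 1 η⟫_ℂ).re) * ‖A‖ := by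
    have hsum : ∑ g : G, ⟪η, Q g η⟫_ℂ = 1 := by
      rw [← inner_sum, ← sum_apply, hQsum, one_apply_eq_self, inner_self_eq_norm_sq_to_K, hη]
      simp
    have hA : US 1 * A * adjoint (US 1) = A := by
      rw [hUS1, ← star_eq_adjoint, star_one, one_mul, mul_one]
    have h := norm_sum_smul_sub_le (fun g => ⟪η, Q g η⟫_ℂ) (fun g => hQpos g η) hsum
      (fun g => US g * A * adjoint (US g)) 1
      (fun g => by simp only [norm_unitary_conj (hUSuni _), le_refl])
    rw [← eq_sum_of_restrict_yen T US Q A E η hE] at h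
    simpa only [hA] using h
  refine ⟨bound, fun η E hη hE hlim => ?_⟩
  rw [tendsto_iff_norm_sub_tendsto_zero]
  refine squeeze_zero (fun _ => norm_nonneg _) (fun n => bound (η n) (hη n) (E n) (hE n)) ?_
  have hre := (Complex.continuous_re.tendsto 1).comp hlim
  simpa using ((hre.const_sub 1).const_mul 2).mul_const ‖A‖

end
end
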